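/- Let α = 3/2 and β = 1/2. Then there exists a constant C such that for every k ∈ ℝ² with |k| ≥ 2 and every Y ∈ ℝ: ∫_{ℝ²} |x|^{−3/2} |k−x|^{−3/2} (1+|Y−|x|−|k−x||)^{−1/2} dx ≤ C·|k|^{−3/2}·(log|k|)². -/

import Mathlib

open MeasureTheory Real

/-- The half strip on which `Complex.cosh` is injective and covers almost all of `ℂ`. -/
def halfStrip : Set ℂ := {z | 0 < z.re ∧ z.im ∈ Set.Ioc (-π) π}

theorem measurableSet_halfStrip : MeasurableSet halfStrip :=
  (measurableSet_lt measurable_const Complex.measurable_re).inter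
    (Complex.measurable_im measurableSet_Ioc)

theorem Complex.injOn_cosh_halfStrip : Set.InjOn Complex.cosh halfStrip := by
  rintro a ⟨ha, ha'⟩ b ⟨hb, hb'⟩ h
  have hprod : (Complex.exp a - Complex.exp b) * (Complex.exp (a + b) - 1) = 0 := by
    have ha0 := Complex.exp_ne_zero a
    have hb0 := Complex.exp_ne_zero b
    simp only [Complex.cosh, Complex.exp_neg] at h
    field_simp at h
    rw [Complex.exp_add]
    linear_combination h
  rcases mul_eq_zero.1 hprod with h1 | h1
  · rw [← Complex.log_exp ha'.1 ha'.2, ← Complex.log_exp hb'.1 hb'.2, sub_eq_zero.1 h1]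
  · have h2 := congrArg norm (sub_eq_zero.1 h1)
    rw [Complex.norm_exp, norm_one, Real.exp_eq_one_iff, Complex.add_re] at h2
    linarith

theorem Complex.exists_cosh_eq (w : ℂ) :
    ∃ z : ℂ, 0 ≤ z.re ∧ z.im ∈ Set.Ioc (-π) π ∧ Complex.cosh z = w := by
  have key : ∃ z : ℂ, 0 ≤ z.re ∧ Complex.cosh z = w := by
    obtain ⟨u, hu⟩ := Complex.cos_surjective w
    rw [← Complex.cosh_mul_I] at hu
    rcases le_total 0 (u * Complex.I).re with h | h
    · exact ⟨_, h, hu⟩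
    · exact ⟨-(u * Complex.I), by simpa using h, by rw [Complex.cosh_neg, hu]⟩
  obtain ⟨z, hz, hw⟩ := key
  have he := Complex.exp_log (Complex.exp_ne_zero z)
  refine ⟨Complex.log (Complex.exp z), ?_, ⟨Complex.neg_pi_lt_log_im _, Complex.log_im_le_pi _⟩, ?_⟩
  · rw [Complex.log_re, Complex.norm_exp, Real.log_exp]
    exact hz
  · rw [← hw, Complex.cosh, Complex.cosh, Complex.exp_neg, Complex.exp_neg, he]

theorem Complex.volume_re_eq_zero : volume {z : ℂ | z.re = 0} = 0 := by
  have h : {z : ℂ | z.re = 0} = Complex.measurableEquivRealProd ⁻¹' ({0} ×ˢ Set.univ) := by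
    ext z
    simp [Complex.measurableEquivRealProd_apply]
  rw [h, Complex.volume_preserving_equiv_real_prod.measure_preimage
    ((measurableSet_singleton 0).prod MeasurableSet.univ).nullMeasurableSet,
    Measure.volume_eq_prod, Measure.prod_prod]
  simp

/-- Elliptic coordinates with foci `0` and `k`. -/
theorem lintegral_le_lintegral_elliptic {k : ℂ} (hk : k ≠ 0) (F : ℂ → ENNReal) :
    ∫⁻ x, F x ≤ ∫⁻ z in halfStrip,
      ENNReal.ofReal (‖k / 2 * Complex.sinh z‖ ^ 2) * F (k / 2 * (1 + Complex.cosh z)) := by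
  set f : ℂ → ℂ := fun z => k / 2 * (1 + Complex.cosh z) with hf
  have hder : ∀ z, HasDerivAt f (k / 2 * Complex.sinh z) z := fun z =>
    ((Complex.hasDerivAt_cosh z).const_add 1).const_mul (k / 2)
  have hfd : ∀ z, HasFDerivAt f
      ((ContinuousLinearMap.toSpanSingleton ℂ (k / 2 * Complex.sinh z)).restrictScalars ℝ) z :=
    fun z => (hder z).hasFDerivAt.restrictScalars ℝ
  have hinj : Set.InjOn f halfStrip := by
    intro a ha b hb hab
    refine Complex.injOn_cosh_halfStrip ha hb ?_
    simpa [hf, hk] using hab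
  have hdet : ∀ w : ℂ, ((ContinuousLinearMap.toSpanSingleton ℂ w).restrictScalars ℝ).det
      = ‖w‖ ^ 2 := by
    intro w
    simp [ContinuousLinearMap.det, LinearMap.det_restrictScalars, Algebra.norm_complex_apply,
      Complex.normSq_eq_norm_sq]
  have hcov : Set.univ ⊆ f '' halfStrip ∪ f '' {z : ℂ | z.re = 0} := by
    intro x _
    obtain ⟨z, hz, hz', hw⟩ := Complex.exists_cosh_eq (2 * x / k - 1)
    have hx : f z = x := by
      simp only [hf, hw]
      field_simp
      ring
    rcases hz.eq_or_lt with h | h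
    · exact Or.inr ⟨z, h.symm, hx⟩
    · exact Or.inl ⟨z, ⟨h, hz'⟩, hx⟩
  have hnull : volume (f '' {z : ℂ | z.re = 0}) = 0 :=
    addHaar_image_eq_zero_of_differentiableOn_of_addHaar_eq_zero volume
      (fun z _ => (hfd z).differentiableAt.differentiableWithinAt) Complex.volume_re_eq_zero
  calc ∫⁻ x, F x = ∫⁻ x in Set.univ, F x := by simp
    _ ≤ ∫⁻ x in f '' halfStrip ∪ f '' {z : ℂ | z.re = 0}, F x := lintegral_mono_set hcov
    _ ≤ (∫⁻ x in f '' halfStrip, F x) + ∫⁻ x in f '' {z : ℂ | z.re = 0}, F x :=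
        lintegral_union_le _ _ _
    _ = ∫⁻ x in f '' halfStrip, F x := by rw [setLIntegral_measure_zero _ _ hnull, add_zero]
    _ = _ := by
      rw [lintegral_image_eq_lintegral_abs_det_fderiv_mul volume measurableSet_halfStrip
        (fun z _ => (hfd z).hasFDerivWithinAt) hinj F]
      refine lintegral_congr fun z => ?_
      rw [hdet, abs_of_nonneg (by positivity)]

theorem Complex.norm_sinh_sq (z : ℂ) :
    ‖Complex.sinh z‖ ^ 2 = Real.sinh z.re ^ 2 + Real.sin z.im ^ 2 := by
  conv_lhs => rw [← Complex.re_add_im z]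
  rw [Complex.sinh_add, Complex.sinh_mul_I, Complex.cosh_mul_I, ← Complex.normSq_eq_norm_sq,
    ← Complex.ofReal_sinh, ← Complex.ofReal_cosh, ← Complex.ofReal_sin, ← Complex.ofReal_cos,
    Complex.normSq_apply]
  simp [Complex.sinh_ofReal_re, Complex.cosh_ofReal_re, Complex.sin_ofReal_re,
    Complex.cos_ofReal_re]
  have h1 := Real.cosh_sq z.re
  have h2 := Real.sin_sq_add_cos_sq z.im
  linear_combination (Real.sin z.im ^ 2) * h1 + Real.sinh z.re ^ 2 * h2

theorem Complex.norm_cosh_sq (z : ℂ) :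
    ‖Complex.cosh z‖ ^ 2 = Real.sinh z.re ^ 2 + Real.cos z.im ^ 2 := by
  conv_lhs => rw [← Complex.re_add_im z]
  rw [Complex.cosh_add, Complex.sinh_mul_I, Complex.cosh_mul_I, ← Complex.normSq_eq_norm_sq,
    ← Complex.ofReal_sinh, ← Complex.ofReal_cosh, ← Complex.ofReal_sin, ← Complex.ofReal_cos,
    Complex.normSq_apply]
  simp [Complex.sinh_ofReal_re, Complex.cosh_ofReal_re, Complex.sin_ofReal_re,
    Complex.cos_ofReal_re]
  have h1 := Real.cosh_sq z.re
  have h2 := Real.sin_sq_add_cos_sq z.im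
  linear_combination (Real.cos z.im ^ 2) * h1 + Real.sinh z.re ^ 2 * h2

theorem Complex.norm_one_add_cosh_add_norm_one_sub_cosh (z : ℂ) :
    ‖1 + Complex.cosh z‖ + ‖1 - Complex.cosh z‖ = 2 * Real.cosh z.re := by
  have hz : z = 2 * (z / 2) := by ring
  have h1 : 1 + Complex.cosh z = 2 * Complex.cosh (z / 2) ^ 2 := by
    conv_lhs => rw [hz, Complex.cosh_two_mul]
    linear_combination - Complex.cosh_sq (z / 2)
  have h2 : 1 - Complex.cosh z = -(2 * Complex.sinh (z / 2) ^ 2) := by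
    conv_lhs => rw [hz, Complex.cosh_two_mul]
    linear_combination - Complex.cosh_sq (z / 2)
  rw [h1, h2, norm_neg, norm_mul, norm_mul, norm_pow, norm_pow, Complex.norm_sinh_sq,
    Complex.norm_cosh_sq]
  have h3 : z.re = 2 * (z / 2).re := by simp; ring
  rw [h3, Real.cosh_two_mul, Complex.norm_two]
  have h4 := Real.cosh_sq (z / 2).re
  have h5 := Real.sin_sq_add_cos_sq (z / 2).im
  linear_combination 2 * h5 - 2 * h4

theorem elliptic_integrand_eq {k z : ℂ} (hk : k ≠ 0) (hz : Complex.sinh z ≠ 0) (Y : ℝ) :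
    ‖k / 2 * Complex.sinh z‖ ^ 2 *
      (‖k / 2 * (1 + Complex.cosh z)‖ ^ (-(3 : ℝ) / 2) *
        ‖k - k / 2 * (1 + Complex.cosh z)‖ ^ (-(3 : ℝ) / 2) *
        (1 + |Y - ‖k / 2 * (1 + Complex.cosh z)‖ -
          ‖k - k / 2 * (1 + Complex.cosh z)‖|) ^ (-(1 : ℝ) / 2))
      = 2 / ‖k‖ * (‖Complex.sinh z‖⁻¹ *
        (1 + |Y - ‖k‖ * Real.cosh z.re|) ^ (-(1 : ℝ) / 2)) := by
  have hsub : k - k / 2 * (1 + Complex.cosh z) = k / 2 * (1 - Complex.cosh z) := by ring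
  have hsum : Y - ‖k / 2 * (1 + Complex.cosh z)‖ - ‖k / 2 * (1 - Complex.cosh z)‖
      = Y - ‖k‖ * Real.cosh z.re := by
    rw [norm_mul, norm_mul, norm_div, Complex.norm_two]
    linear_combination (-‖k‖ / 2) * Complex.norm_one_add_cosh_add_norm_one_sub_cosh z
  set s := ‖k / 2 * Complex.sinh z‖ with hs
  have hspos : 0 < s := norm_pos_iff.2 (by simp [hk, hz])
  have hmul : ‖k / 2 * (1 + Complex.cosh z)‖ * ‖k / 2 * (1 - Complex.cosh z)‖ = s ^ 2 := by
    rw [hs, ← norm_mul, ← norm_pow, ← norm_neg]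
    congr 1
    linear_combination (k / 2) ^ 2 * Complex.cosh_sq z
  have hpow : s ^ 2 * (s ^ 2) ^ (-(3 : ℝ) / 2) = s⁻¹ := by
    rw [← Real.rpow_natCast, ← Real.rpow_mul hspos.le, ← Real.rpow_add hspos,
      ← Real.rpow_neg_one]
    norm_num
  have hinv : s⁻¹ = 2 / ‖k‖ * ‖Complex.sinh z‖⁻¹ := by
    rw [hs, norm_mul, norm_div, Complex.norm_two]
    field_simp
  rw [hsub, hsum, ← Real.mul_rpow (norm_nonneg _) (norm_nonneg _), hmul, ← mul_assoc, hpow, hinv,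
    mul_assoc]

/-- A translated product of two antitone functions is dominated, in integral, by the
untranslated one. -/
theorem lintegral_mul_abs_sub_le {f g : ℝ → ENNReal} (hf : AntitoneOn f (Set.Ioi 0))
    (hg : AntitoneOn g (Set.Ioi 0)) (hfm : Measurable f) (hgm : Measurable g) (m : ℝ) :
    ∫⁻ t in Set.Ioi 0, f t * g |t - m| ≤ 3 * ∫⁻ t in Set.Ioi 0, f t * g t := by
  set I := ∫⁻ t in Set.Ioi 0, f t * g t with hI
  have hhm : Measurable fun t : ℝ => f |t| * g |t| := by fun_prop
  have habs : ∫⁻ t : ℝ, f |t| * g |t| ≤ I + I := by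
    have hcov : (Set.univ : Set ℝ) ⊆ (Set.Ioi 0 ∪ Set.Iio 0) ∪ {0} := by
      intro t _
      rcases lt_trichotomy t 0 with h | h | h <;> simp [h, em]
    have hpos : ∫⁻ t in Set.Ioi (0 : ℝ), f |t| * g |t| = I :=
      setLIntegral_congr_fun measurableSet_Ioi fun t ht => by
        simp only [abs_of_pos (Set.mem_Ioi.1 ht)]
    have hneg : ∫⁻ t in Set.Iio (0 : ℝ), f |t| * g |t| = I := by
      have h := (Measure.measurePreserving_neg (volume : Measure ℝ)).setLIntegral_comp_preimage
        (measurableSet_Ioi (a := (0 : ℝ))) hhm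
      rw [hpos] at h
      rw [← h]
      simp
    calc ∫⁻ t : ℝ, f |t| * g |t| = ∫⁻ t in Set.univ, f |t| * g |t| := by simp
      _ ≤ ∫⁻ t in (Set.Ioi 0 ∪ Set.Iio 0) ∪ {0}, f |t| * g |t| := lintegral_mono_set hcov
      _ ≤ _ := lintegral_union_le _ _ _
      _ ≤ (∫⁻ t in Set.Ioi 0, f |t| * g |t|) + (∫⁻ t in Set.Iio 0, f |t| * g |t|) + 0 := by
        gcongr
        · exact lintegral_union_le _ _ _
        · simp
      _ = I + I := by rw [hpos, hneg, add_zero]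
  have hne : ∀ᵐ t : ℝ ∂volume.restrict (Set.Ioi 0), t ≠ m :=
    ae_restrict_of_ae (by simp [ae_iff])
  calc ∫⁻ t in Set.Ioi 0, f t * g |t - m|
      ≤ ∫⁻ t in Set.Ioi 0, (f t * g t + f |t - m| * g |t - m|) := by
        refine lintegral_mono_ae ?_
        filter_upwards [hne, ae_restrict_mem measurableSet_Ioi] with t htm ht
        have hpos : 0 < |t - m| := abs_pos.2 (sub_ne_zero.2 htm)
        rcases le_total t |t - m| with h | h
        · exact le_add_right (mul_le_mul_right (hg ht hpos h) _)
        · exact le_add_left (mul_le_mul_left (hf hpos ht h) _)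
    _ = I + ∫⁻ t in Set.Ioi 0, f |t - m| * g |t - m| := lintegral_add_left (by fun_prop) _
    _ ≤ I + ∫⁻ t : ℝ, f |t - m| * g |t - m| := by
        gcongr
        exact Measure.restrict_le_self
    _ = I + ∫⁻ t : ℝ, f |t| * g |t| := by
        rw [lintegral_sub_right_eq_self (fun t : ℝ => f |t| * g |t|) m]
    _ ≤ I + (I + I) := by gcongr
    _ = 3 * I := by ring

theorem Real.sq_sub_le_abs_cosh_sub_cosh {t m : ℝ} (ht : 0 ≤ t) (hm : 0 ≤ m) :
    |t - m| ^ 2 / 2 ≤ |Real.cosh t - Real.cosh m| := by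
  wlog h : m ≤ t generalizing t m
  · rw [abs_sub_comm, abs_sub_comm (Real.cosh t)]
    exact this hm ht (le_of_not_ge h)
  have h1 : Real.cosh t - Real.cosh m = 2 * Real.sinh ((t + m) / 2) * Real.sinh ((t - m) / 2) := by
    have e1 : Real.cosh t = Real.cosh ((t + m) / 2 + (t - m) / 2) := by congr 1; ring
    have e2 : Real.cosh m = Real.cosh ((t + m) / 2 - (t - m) / 2) := by congr 1; ring
    rw [e1, e2, Real.cosh_add, Real.cosh_sub]
    ring
  have h2 : (t + m) / 2 ≤ Real.sinh ((t + m) / 2) := Real.self_le_sinh_iff.2 (by linarith)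
  have h3 : (t - m) / 2 ≤ Real.sinh ((t - m) / 2) := Real.self_le_sinh_iff.2 (by linarith)
  have h4 : (t + m) / 2 * ((t - m) / 2) ≤ Real.sinh ((t + m) / 2) * Real.sinh ((t - m) / 2) :=
    mul_le_mul h2 h3 (by linarith) (by linarith)
  refine le_trans ?_ (le_abs_self _)
  rw [sq_abs, h1]
  nlinarith

theorem exists_abs_sub_sq_le {K : ℝ} (hK : 0 < K) (Y : ℝ) :
    ∃ m : ℝ, ∀ t, 0 ≤ t → K * |t - m| ^ 2 / 2 ≤ |Y - K * Real.cosh t| := by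
  rcases le_total 1 (Y / K) with h | h
  · refine ⟨Real.arcosh (Y / K), fun t ht => ?_⟩
    have h1 := Real.sq_sub_le_abs_cosh_sub_cosh ht (Real.arcosh_nonneg h)
    rw [Real.cosh_arcosh h] at h1
    have h2 : Y - K * Real.cosh t = -(K * (Real.cosh t - Y / K)) := by field_simp; ring
    rw [h2, abs_neg, abs_mul, abs_of_pos hK, mul_div_assoc]
    gcongr
  · refine ⟨0, fun t ht => ?_⟩
    have h1 := Real.sq_sub_le_abs_cosh_sub_cosh ht le_rfl
    rw [Real.cosh_zero, abs_of_nonneg (sub_nonneg.2 (Real.one_le_cosh t))] at h1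
    rw [div_le_one hK] at h
    rw [abs_sub_comm Y]
    refine le_trans ?_ (le_abs_self _)
    nlinarith

theorem lintegral_Ioc_inv_add {t : ℝ} (ht : 0 < t) :
    ∫⁻ y in Set.Ioc 0 π, ENNReal.ofReal (t + y)⁻¹ = ENNReal.ofReal (Real.log (1 + π / t)) := by
  have hderiv : ∀ y ∈ Set.uIcc 0 π, HasDerivAt (fun y => Real.log (t + y)) (t + y)⁻¹ y := by
    intro y hy
    rw [Set.uIcc_of_le pi_pos.le] at hy
    have := ((hasDerivAt_id y).const_add t).log (by have := hy.1; simp; positivity)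
    simpa using this
  have hcont : ContinuousOn (fun y : ℝ => (t + y)⁻¹) (Set.uIcc 0 π) := by
    rw [Set.uIcc_of_le pi_pos.le]
    refine ContinuousOn.inv₀ (by fun_prop) fun y hy => ?_
    have := hy.1
    positivity
  have hintg := hcont.intervalIntegrable (μ := volume)
  have h := intervalIntegral.integral_eq_sub_of_hasDerivAt hderiv hintg
  rw [intervalIntegral.integral_of_le pi_pos.le] at h
  rw [← ofReal_integral_eq_lintegral_ofReal hintg.1, h]
  · rw [add_zero, ← Real.log_div (by positivity) ht.ne']
    congr 2
    field_simp
  · filter_upwards [ae_restrict_mem measurableSet_Ioc] with y hy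
    have := hy.1
    simp only [Pi.zero_apply]
    positivity

theorem Complex.inv_norm_sinh_le {z : ℂ} (hz : z ∈ halfStrip) :
    ‖Complex.sinh z‖⁻¹ ≤ π * ((z.re + |z.im|)⁻¹ + (z.re + (π - |z.im|))⁻¹) := by
  obtain ⟨hre, him⟩ := hz
  have hπ := Real.pi_gt_three
  have him' : |z.im| ≤ π := abs_le.2 ⟨him.1.le, him.2⟩
  have hsq := Complex.norm_sinh_sq z
  have h1 : z.re ≤ ‖Complex.sinh z‖ := by
    refine (Real.self_le_sinh_iff.2 hre.le).trans (abs_le_of_sq_le_sq' ?_ (norm_nonneg _)).2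
    nlinarith [sq_nonneg (Real.sin z.im)]
  have h2 : Real.sin |z.im| ≤ ‖Complex.sinh z‖ := by
    refine (abs_le_of_sq_le_sq' ?_ (norm_nonneg _)).2
    have h3 : Real.sin |z.im| ^ 2 = Real.sin z.im ^ 2 := by
      rcases abs_choice z.im with h | h <;> simp [h]
    nlinarith [sq_nonneg (Real.sinh z.re)]
  have key : ∀ y : ℝ, 0 ≤ y → 2 / π * y ≤ ‖Complex.sinh z‖ →
      ‖Complex.sinh z‖⁻¹ ≤ π * (z.re + y)⁻¹ := by
    intro y hy h
    rw [← div_eq_mul_inv, inv_le_comm₀ (by linarith) (by positivity), inv_div,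
      div_le_iff₀ (by positivity)]
    have h4 : y ≤ ‖Complex.sinh z‖ * π / 2 := by
      rw [div_mul_eq_mul_div, div_le_iff₀ (by positivity)] at h
      linarith
    nlinarith
  rw [mul_add]
  rcases le_total |z.im| (π / 2) with h | h
  · refine (key _ (abs_nonneg _) ((Real.mul_le_sin (abs_nonneg _) h).trans h2)).trans ?_
    have : 0 ≤ π * (z.re + (π - |z.im|))⁻¹ :=
      mul_nonneg pi_pos.le (inv_nonneg.2 (by linarith))
    linarith
  · have h5 := Real.mul_le_sin (x := π - |z.im|) (by linarith) (by linarith)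
    rw [Real.sin_pi_sub] at h5
    refine (key _ (by linarith) (h5.trans h2)).trans ?_
    have : 0 ≤ π * (z.re + |z.im|)⁻¹ := by positivity
    linarith

theorem lintegral_Ioc_inv_add_pi_sub {t : ℝ} (ht : 0 < t) :
    ∫⁻ y in Set.Ioc 0 π, ENNReal.ofReal (t + (π - y))⁻¹
      = ENNReal.ofReal (Real.log (1 + π / t)) := by
  have h := (Measure.measurePreserving_sub_left (volume : Measure ℝ) π).setLIntegral_comp_preimage
    (s := Set.Ico 0 π) measurableSet_Ico
    (f := fun y => ENNReal.ofReal (t + y)⁻¹) (by fun_prop)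
  rw [Set.preimage_const_sub_Ico, sub_self, sub_zero, setLIntegral_congr Ico_ae_eq_Ioc,
    lintegral_Ioc_inv_add ht] at h
  exact h

theorem lintegral_Ioc_abs {a : ℝ} {f : ℝ → ENNReal} (hf : Measurable f) :
    ∫⁻ y in Set.Ioc (-a) a, f |y| ≤ 2 * ∫⁻ y in Set.Ioc 0 a, f y := by
  have hcov : Set.Ioc (-a) a ⊆ (Set.Ioc 0 a ∪ Set.Ico (-a) 0) ∪ {0} := by
    rintro y ⟨h1, h2⟩
    rcases lt_trichotomy y 0 with h | h | h
    · exact Or.inl (Or.inr ⟨h1.le, h⟩)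
    · exact Or.inr h
    · exact Or.inl (Or.inl ⟨h, h2⟩)
  have hpos : ∫⁻ y in Set.Ioc 0 a, f |y| = ∫⁻ y in Set.Ioc 0 a, f y :=
    setLIntegral_congr_fun measurableSet_Ioc fun y hy => by simp only [abs_of_pos hy.1]
  have hneg : ∫⁻ y in Set.Ico (-a) 0, f |y| = ∫⁻ y in Set.Ioc 0 a, f |y| := by
    have h := (Measure.measurePreserving_neg (volume : Measure ℝ)).setLIntegral_comp_preimage
      (measurableSet_Ioc (a := (0 : ℝ)) (b := a)) (f := fun y => f |y|) (by fun_prop)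
    rw [← h]
    simp
  calc ∫⁻ y in Set.Ioc (-a) a, f |y|
      ≤ ∫⁻ y in (Set.Ioc 0 a ∪ Set.Ico (-a) 0) ∪ {0}, f |y| := lintegral_mono_set hcov
    _ ≤ _ := lintegral_union_le _ _ _
    _ ≤ (∫⁻ y in Set.Ioc 0 a, f |y|) + (∫⁻ y in Set.Ico (-a) 0, f |y|) + 0 := by
      gcongr
      · exact lintegral_union_le _ _ _
      · simp
    _ = 2 * ∫⁻ y in Set.Ioc 0 a, f y := by rw [hneg, hpos, add_zero, two_mul]

theorem lintegral_inv_norm_sinh_le {t : ℝ} (ht : 0 < t) :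
    ∫⁻ y in Set.Ioc (-π) π, ENNReal.ofReal ‖Complex.sinh ⟨t, y⟩‖⁻¹
      ≤ ENNReal.ofReal (4 * π) * ENNReal.ofReal (Real.log (1 + π / t)) := by
  set L := ENNReal.ofReal (Real.log (1 + π / t)) with hL
  set f : ℝ → ENNReal := fun y => ENNReal.ofReal π *
    (ENNReal.ofReal (t + y)⁻¹ + ENNReal.ofReal (t + (π - y))⁻¹) with hf
  have hfm : Measurable f := by fun_prop
  have hintg : ∫⁻ y in Set.Ioc 0 π, f y = ENNReal.ofReal π * (L + L) := by
    rw [hf, lintegral_const_mul _ (by fun_prop), lintegral_add_left (by fun_prop),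
      lintegral_Ioc_inv_add ht, lintegral_Ioc_inv_add_pi_sub ht]
  calc ∫⁻ y in Set.Ioc (-π) π, ENNReal.ofReal ‖Complex.sinh ⟨t, y⟩‖⁻¹
      ≤ ∫⁻ y in Set.Ioc (-π) π, f |y| := by
        refine setLIntegral_mono (by fun_prop) fun y hy => ?_
        have hy' : |y| ≤ π := abs_le.2 ⟨hy.1.le, hy.2⟩
        have h := Complex.inv_norm_sinh_le (z := ⟨t, y⟩) ⟨ht, hy⟩
        refine (ENNReal.ofReal_le_ofReal h).trans ?_
        rw [ENNReal.ofReal_mul pi_pos.le, ENNReal.ofReal_add (by positivity)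
          (inv_nonneg.2 (by simp only; linarith))]
    _ ≤ 2 * (ENNReal.ofReal π * (L + L)) := (lintegral_Ioc_abs hfm).trans_eq (by rw [hintg])
    _ = ENNReal.ofReal (4 * π) * L := by
        rw [ENNReal.ofReal_mul (by norm_num)]
        norm_num
        ring

/-- The kernel bounding the oscillating factor in elliptic coordinates. -/
noncomputable def radialKernel (K t : ℝ) : ℝ := (1 + K * t ^ 2 / 2) ^ (-(1 : ℝ) / 2)

theorem measurable_radialKernel (K : ℝ) : Measurable (radialKernel K) := by
  unfold radialKernel
  fun_prop

theorem antitoneOn_radialKernel {K : ℝ} (hK : 0 ≤ K) :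
    AntitoneOn (radialKernel K) (Set.Ioi 0) := by
  intro s hs t ht hst
  rw [Set.mem_Ioi] at hs ht
  exact Real.rpow_le_rpow_of_nonpos (by positivity) (by gcongr) (by norm_num)

theorem radialKernel_le_one {K : ℝ} (hK : 0 ≤ K) (t : ℝ) : radialKernel K t ≤ 1 :=
  Real.rpow_le_one_of_one_le_of_nonpos (by have := sq_nonneg t; nlinarith [mul_nonneg hK this])
    (by norm_num)

theorem radialKernel_le {K t : ℝ} (hK : 0 < K) (ht : 0 < t) :
    radialKernel K t ≤ 2 * K ^ (-(1 : ℝ) / 2) * t⁻¹ := by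
  have h1 : radialKernel K t ≤ (K * t ^ 2 / 4) ^ (-(1 : ℝ) / 2) :=
    Real.rpow_le_rpow_of_nonpos (by positivity) (by have : 0 < K * t ^ 2 := by positivity
                                                    linarith) (by norm_num)
  have h2 : K * t ^ 2 / 4 = K * (t / 2) ^ 2 := by ring
  have h3 : ((t / 2) ^ 2) ^ (-(1 : ℝ) / 2) = (t / 2)⁻¹ := by
    rw [← Real.rpow_natCast, ← Real.rpow_mul (by positivity), ← Real.rpow_neg_one]
    norm_num
  rw [h2, Real.mul_rpow hK.le (by positivity), h3, inv_div] at h1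
  exact h1.trans_eq (by ring)

theorem antitoneOn_log_one_add_div : AntitoneOn (fun t => Real.log (1 + π / t)) (Set.Ioi 0) := by
  intro s hs t ht hst
  rw [Set.mem_Ioi] at hs ht
  simp only
  gcongr

theorem lintegral_Ioc_log_mul_radialKernel_le {K ε : ℝ} (hK : 0 ≤ K) (hε : 0 < ε) :
    ∫⁻ t in Set.Ioc 0 ε, ENNReal.ofReal (Real.log (1 + π / t) * radialKernel K t)
      ≤ ENNReal.ofReal (ε * (Real.log (1 + π / ε) + 1)) := by
  set L := Real.log (1 + π / ε) with hL
  have hL0 : 0 ≤ L := Real.log_nonneg (by have : 0 < π / ε := by positivity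
                                          linarith)
  have hintg : IntervalIntegrable (fun t => L + Real.log ε - Real.log t) volume 0 ε :=
    intervalIntegrable_const.sub intervalIntegral.intervalIntegrable_log'
  have hval : ∫ t in Set.Ioc 0 ε, (L + Real.log ε - Real.log t) = ε * (L + 1) := by
    rw [← intervalIntegral.integral_of_le hε.le, intervalIntegral.integral_sub
      intervalIntegrable_const intervalIntegral.intervalIntegrable_log', integral_log]
    simp
    ring
  have hnn : 0 ≤ᵐ[volume.restrict (Set.Ioc 0 ε)] fun t => L + Real.log ε - Real.log t := by
    filter_upwards [ae_restrict_mem measurableSet_Ioc] with t ht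
    have := Real.log_le_log ht.1 ht.2
    simp only [Pi.zero_apply]
    linarith
  rw [← hval, ofReal_integral_eq_lintegral_ofReal hintg.1 hnn]
  refine setLIntegral_mono (by fun_prop) fun t ht => ENNReal.ofReal_le_ofReal ?_
  have ht0 := ht.1
  have hp : 0 < π / t := by positivity
  have h1 : Real.log (1 + π / t) ≤ L + Real.log ε - Real.log t := by
    rw [hL, ← Real.log_mul (by positivity) hε.ne', ← Real.log_div (by positivity) ht0.ne']
    gcongr
    have h2 : (1 + π / ε) * ε / t = ε / t + π / t := by field_simp
    have h3 : 1 ≤ ε / t := (one_le_div ht0).2 ht.2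
    linarith
  refine le_trans ?_ h1
  exact mul_le_of_le_one_right (Real.log_nonneg (by linarith)) (radialKernel_le_one hK t)

theorem lintegral_Ioc_one_log_mul_radialKernel_le {K ε : ℝ} (hK : 0 < K) (hε : 0 < ε)
    (hε1 : ε ≤ 1) :
    ∫⁻ t in Set.Ioc ε 1, ENNReal.ofReal (Real.log (1 + π / t) * radialKernel K t)
      ≤ ENNReal.ofReal (2 * K ^ (-(1 : ℝ) / 2) * Real.log (1 + π / ε) * Real.log ε⁻¹) := by
  set L := Real.log (1 + π / ε) with hL
  have hL0 : 0 ≤ L := Real.log_nonneg (by have : 0 < π / ε := by positivity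
                                          linarith)
  have h0 : (0 : ℝ) ∉ Set.uIcc ε 1 := by
    rw [Set.uIcc_of_le hε1]
    exact fun h => absurd h.1 (by linarith)
  have hintg : IntervalIntegrable (fun t : ℝ => 2 * K ^ (-(1 : ℝ) / 2) * L * t⁻¹) volume ε 1 :=
    (intervalIntegral.intervalIntegrable_inv (fun x hx h => h0 (h ▸ hx))
      continuousOn_id).const_mul _
  have hval : ∫ t in Set.Ioc ε 1, 2 * K ^ (-(1 : ℝ) / 2) * L * t⁻¹
      = 2 * K ^ (-(1 : ℝ) / 2) * L * Real.log ε⁻¹ := by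
    rw [← intervalIntegral.integral_of_le hε1, intervalIntegral.integral_const_mul,
      integral_inv h0, one_div]
  have hnn : 0 ≤ᵐ[volume.restrict (Set.Ioc ε 1)]
      fun t : ℝ => 2 * K ^ (-(1 : ℝ) / 2) * L * t⁻¹ := by
    filter_upwards [ae_restrict_mem measurableSet_Ioc] with t ht
    have := hε.trans ht.1
    simp only [Pi.zero_apply]
    positivity
  rw [← hval, ofReal_integral_eq_lintegral_ofReal hintg.1 hnn]
  refine setLIntegral_mono (by fun_prop) fun t ht => ENNReal.ofReal_le_ofReal ?_
  have ht0 := hε.trans ht.1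
  have h1 : Real.log (1 + π / t) ≤ L := antitoneOn_log_one_add_div hε ht0 ht.1.le
  have h2 := radialKernel_le hK ht0
  have h3 : 0 ≤ radialKernel K t := by unfold radialKernel; positivity
  calc _ ≤ L * (2 * K ^ (-(1 : ℝ) / 2) * t⁻¹) := mul_le_mul h1 h2 h3 hL0
    _ = _ := by ring

theorem lintegral_Ioi_one_log_mul_radialKernel_le {K : ℝ} (hK : 0 < K) :
    ∫⁻ t in Set.Ioi 1, ENNReal.ofReal (Real.log (1 + π / t) * radialKernel K t)
      ≤ ENNReal.ofReal (2 * K ^ (-(1 : ℝ) / 2) * π) := by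
  have hintg : IntegrableOn (fun t : ℝ => 2 * K ^ (-(1 : ℝ) / 2) * π * t ^ (-2 : ℝ)) (Set.Ioi 1) :=
    (integrableOn_Ioi_rpow_of_lt (by norm_num) one_pos).const_mul _
  have hval : ∫ t in Set.Ioi (1 : ℝ), 2 * K ^ (-(1 : ℝ) / 2) * π * t ^ (-2 : ℝ)
      = 2 * K ^ (-(1 : ℝ) / 2) * π := by
    rw [integral_const_mul, integral_Ioi_rpow_of_lt (by norm_num) one_pos]
    norm_num
  have hnn : 0 ≤ᵐ[volume.restrict (Set.Ioi 1)]
      fun t : ℝ => 2 * K ^ (-(1 : ℝ) / 2) * π * t ^ (-2 : ℝ) := by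
    filter_upwards [ae_restrict_mem measurableSet_Ioi] with t ht
    have : 0 < t := one_pos.trans ht
    simp only [Pi.zero_apply]
    positivity
  rw [← hval, ofReal_integral_eq_lintegral_ofReal hintg hnn]
  refine setLIntegral_mono (by fun_prop) fun t ht => ENNReal.ofReal_le_ofReal ?_
  have ht0 : 0 < t := one_pos.trans ht
  have h1 : Real.log (1 + π / t) ≤ π / t := by
    have := Real.log_le_sub_one_of_pos (x := 1 + π / t) (by positivity)
    linarith
  have h2 := radialKernel_le hK ht0
  have h3 : 0 ≤ radialKernel K t := by unfold radialKernel; positivity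
  calc _ ≤ π / t * (2 * K ^ (-(1 : ℝ) / 2) * t⁻¹) := mul_le_mul h1 h2 h3 (by positivity)
    _ = _ := by
      rw [Real.rpow_neg ht0.le, Real.rpow_two]
      field_simp

theorem lintegral_log_mul_radialKernel_le {K : ℝ} (hK : 2 ≤ K) :
    ∫⁻ t in Set.Ioi 0, ENNReal.ofReal (Real.log (1 + π / t)) * ENNReal.ofReal (radialKernel K t)
      ≤ ENNReal.ofReal (50 * K ^ (-(1 : ℝ) / 2) * Real.log K ^ 2) := by
  have hK0 : 0 < K := by linarith
  set ε := K ^ (-(1 : ℝ) / 2) with hεdef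
  have hε : 0 < ε := by positivity
  have hε1 : ε ≤ 1 := Real.rpow_le_one_of_one_le_of_nonpos (by linarith) (by norm_num)
  set l := Real.log K with hl
  have hl2 : 1 / 2 ≤ l := by
    have := Real.log_le_log two_pos hK
    have := Real.log_two_gt_d9
    linarith
  have hloginv : Real.log ε⁻¹ = l / 2 := by
    rw [Real.log_inv, hεdef, Real.log_rpow hK0]
    ring
  set L := Real.log (1 + π / ε) with hL
  have hL0 : 0 ≤ L := Real.log_nonneg (by have : 0 < π / ε := by positivity
                                          linarith)
  have hLle : L ≤ 7 / 2 * l := by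
    have h1 : 1 + π / ε ≤ K ^ 3 * ε⁻¹ := by
      have h2 : 1 ≤ ε⁻¹ := (one_le_inv₀ hε).2 hε1
      have h3 : (8 : ℝ) ≤ K ^ 3 := by
        calc (8 : ℝ) = 2 ^ 3 := by norm_num
          _ ≤ K ^ 3 := by gcongr
      rw [div_eq_mul_inv]
      nlinarith [Real.pi_lt_four]
    have h4 := Real.log_le_log (by positivity) h1
    rw [Real.log_mul (by positivity) (by positivity), hloginv, Real.log_pow] at h4
    push_cast at h4
    linarith
  have hcov : Set.Ioi (0 : ℝ) ⊆ (Set.Ioc 0 ε ∪ Set.Ioc ε 1) ∪ Set.Ioi 1 := by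
    rw [Set.Ioc_union_Ioc_eq_Ioc hε.le hε1, Set.Ioc_union_Ioi_eq_Ioi zero_le_one]
  have hπ := Real.pi_lt_four
  calc ∫⁻ t in Set.Ioi 0, ENNReal.ofReal (Real.log (1 + π / t)) *
        ENNReal.ofReal (radialKernel K t)
      = ∫⁻ t in Set.Ioi 0, ENNReal.ofReal (Real.log (1 + π / t) * radialKernel K t) := by
        refine lintegral_congr fun t => (ENNReal.ofReal_mul' ?_).symm
        unfold radialKernel
        positivity
    _ ≤ ∫⁻ t in (Set.Ioc 0 ε ∪ Set.Ioc ε 1) ∪ Set.Ioi 1,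
          ENNReal.ofReal (Real.log (1 + π / t) * radialKernel K t) := lintegral_mono_set hcov
    _ ≤ _ := lintegral_union_le _ _ _
    _ ≤ ENNReal.ofReal (ε * (L + 1)) + ENNReal.ofReal (2 * ε * L * Real.log ε⁻¹) +
          ENNReal.ofReal (2 * ε * π) := by
        gcongr
        · refine (lintegral_union_le _ _ _).trans ?_
          gcongr
          · exact lintegral_Ioc_log_mul_radialKernel_le hK0.le hε
          · exact lintegral_Ioc_one_log_mul_radialKernel_le hK0 hε hε1
        · exact lintegral_Ioi_one_log_mul_radialKernel_le hK0
    _ = ENNReal.ofReal (ε * (L + 1 + L * l + 2 * π)) := by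
        rw [hloginv, ← ENNReal.ofReal_add (by positivity) (by positivity),
          ← ENNReal.ofReal_add (by positivity) (by positivity)]
        congr 1
        ring
    _ ≤ ENNReal.ofReal (50 * ε * l ^ 2) := by
        refine ENNReal.ofReal_le_ofReal ?_
        have h : L + 1 + L * l + 2 * π ≤ 50 * l ^ 2 := by nlinarith
        calc _ ≤ ε * (50 * l ^ 2) := by gcongr
          _ = _ := by ring

/-- The planar integral estimate over `ℂ`. -/
theorem Complex.lintegral_planar_le {k : ℂ} (hk : 2 ≤ ‖k‖) (Y : ℝ) :
    ∫⁻ x : ℂ, ENNReal.ofReal (‖x‖ ^ (-(3 : ℝ) / 2) * ‖k - x‖ ^ (-(3 : ℝ) / 2) *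
        (1 + |Y - ‖x‖ - ‖k - x‖|) ^ (-(1 : ℝ) / 2))
      ≤ ENNReal.ofReal (1200 * π * ‖k‖ ^ (-(3 : ℝ) / 2) * Real.log ‖k‖ ^ 2) := by
  set K := ‖k‖ with hKdef
  have hK0 : 0 < K := by linarith
  have hk0 : k ≠ 0 := norm_pos_iff.1 hK0
  obtain ⟨m, hm⟩ := exists_abs_sub_sq_le hK0 Y
  set H : ℝ × ℝ → ENNReal := fun p => ENNReal.ofReal (2 / K) *
    (ENNReal.ofReal ‖Complex.sinh ⟨p.1, p.2⟩‖⁻¹ * ENNReal.ofReal (radialKernel K |p.1 - m|)) with hH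
  have hmk := measurable_radialKernel K
  have hsm : Measurable fun p : ℝ × ℝ => Complex.sinh ⟨p.1, p.2⟩ :=
    Complex.measurable_sinh.comp Complex.measurableEquivRealProd.symm.measurable
  have hHm : Measurable H := by fun_prop
  have hstrip : halfStrip = Complex.measurableEquivRealProd ⁻¹' (Set.Ioi 0 ×ˢ Set.Ioc (-π) π) := by
    ext z
    simp [halfStrip, Complex.measurableEquivRealProd_apply]
  calc _ ≤ _ := lintegral_le_lintegral_elliptic hk0 _
    _ ≤ ∫⁻ z in halfStrip, H (Complex.measurableEquivRealProd z) := by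
        refine setLIntegral_mono (by fun_prop) fun z hz => ?_
        have hs : Complex.sinh z ≠ 0 := by
          intro h0
          have h1 := Complex.norm_sinh_sq z
          have h2 : 0 < Real.sinh z.re := Real.sinh_pos_iff.2 hz.1
          rw [h0, norm_zero] at h1
          nlinarith [sq_nonneg (Real.sin z.im)]
        rw [← ENNReal.ofReal_mul (by positivity), elliptic_integrand_eq hk0 hs, hH]
        simp only [Complex.measurableEquivRealProd_apply, Complex.eta]
        rw [← ENNReal.ofReal_mul (by positivity), ← ENNReal.ofReal_mul (by positivity)]
        refine ENNReal.ofReal_le_ofReal ?_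
        rw [← hKdef]
        gcongr
        refine Real.rpow_le_rpow_of_nonpos (by positivity) ?_ (by norm_num)
        have := hm z.re hz.1.le
        linarith
    _ = ∫⁻ p in Set.Ioi 0 ×ˢ Set.Ioc (-π) π, H p := by
        rw [hstrip, Complex.volume_preserving_equiv_real_prod.setLIntegral_comp_preimage
          (measurableSet_Ioi.prod measurableSet_Ioc) hHm]
    _ = ∫⁻ t in Set.Ioi 0, ∫⁻ y in Set.Ioc (-π) π, H (t, y) := by
        rw [Measure.volume_eq_prod, ← Measure.prod_restrict, lintegral_prod _ hHm.aemeasurable]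
    _ ≤ ∫⁻ t in Set.Ioi 0, ENNReal.ofReal (2 / K) * ENNReal.ofReal (4 * π) *
          (ENNReal.ofReal (Real.log (1 + π / t)) * ENNReal.ofReal (radialKernel K |t - m|)) := by
        refine setLIntegral_mono (by fun_prop) fun t ht => ?_
        have hst : Measurable fun y : ℝ => Complex.sinh ⟨t, y⟩ :=
          hsm.comp measurable_prodMk_left
        simp only [hH]
        rw [lintegral_const_mul _ (by fun_prop), lintegral_mul_const _ (by fun_prop), mul_assoc,
          ← mul_assoc (ENNReal.ofReal (4 * π))]
        gcongr
        exact lintegral_inv_norm_sinh_le ht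
    _ = ENNReal.ofReal (2 / K) * ENNReal.ofReal (4 * π) * ∫⁻ t in Set.Ioi 0,
          ENNReal.ofReal (Real.log (1 + π / t)) * ENNReal.ofReal (radialKernel K |t - m|) :=
        lintegral_const_mul _ (by fun_prop)
    _ ≤ ENNReal.ofReal (2 / K) * ENNReal.ofReal (4 * π) *
          (3 * ENNReal.ofReal (50 * K ^ (-(1 : ℝ) / 2) * Real.log K ^ 2)) := by
        gcongr
        refine (lintegral_mul_abs_sub_le (f := fun t => ENNReal.ofReal (Real.log (1 + π / t)))
          (g := fun t => ENNReal.ofReal (radialKernel K t)) ?_ ?_ (by fun_prop) (by fun_prop)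
          m).trans ?_
        · exact ENNReal.ofReal_mono.comp_antitoneOn antitoneOn_log_one_add_div
        · exact ENNReal.ofReal_mono.comp_antitoneOn (antitoneOn_radialKernel hK0.le)
        · gcongr
          exact lintegral_log_mul_radialKernel_le hk
    _ = ENNReal.ofReal (1200 * π * K ^ (-(3 : ℝ) / 2) * Real.log K ^ 2) := by
        have h3 : (3 : ENNReal) = ENNReal.ofReal 3 := by simp
        rw [h3, ← ENNReal.ofReal_mul (by positivity), ← ENNReal.ofReal_mul (by positivity),
          ← ENNReal.ofReal_mul (by positivity)]
        have hpow : K ^ (-(3 : ℝ) / 2) = K⁻¹ * K ^ (-(1 : ℝ) / 2) := by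
          rw [← Real.rpow_neg_one, ← Real.rpow_add hK0]
          norm_num
        rw [hpow]
        congr 1
        ring

/-- Lemma (planar integral estimate, case `α = 3/2`, `β = 1/2`). -/
theorem planar_integral_estimate_three :
    ∃ C : ℝ, ∀ k : EuclideanSpace ℝ (Fin 2), 2 ≤ ‖k‖ → ∀ Y : ℝ,
      (∫ x : EuclideanSpace ℝ (Fin 2),
          ‖x‖ ^ (-(3 : ℝ) / 2) * ‖k - x‖ ^ (-(3 : ℝ) / 2) *
            (1 + |Y - ‖x‖ - ‖k - x‖|) ^ (-(1 : ℝ) / 2))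
        ≤ C * ‖k‖ ^ (-(3 : ℝ) / 2) * Real.log ‖k‖ ^ 2 := by
  refine ⟨1200 * π, fun k hk Y => ?_⟩
  set e := Complex.orthonormalBasisOneI.repr with he
  have hnorm : ‖e.symm k‖ = ‖k‖ := e.symm.norm_map k
  have hcomp := e.measurePreserving.lintegral_comp_emb
    e.toHomeomorph.measurableEmbedding (fun x : EuclideanSpace ℝ (Fin 2) =>
      ENNReal.ofReal (‖x‖ ^ (-(3 : ℝ) / 2) * ‖k - x‖ ^ (-(3 : ℝ) / 2) *
        (1 + |Y - ‖x‖ - ‖k - x‖|) ^ (-(1 : ℝ) / 2)))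
  have hsub : ∀ z : ℂ, ‖k - e z‖ = ‖e.symm k - z‖ := fun z => by
    rw [← e.norm_map (e.symm k - z), map_sub, e.apply_symm_apply]
  simp only [hsub, e.norm_map] at hcomp
  have hbound := Complex.lintegral_planar_le (k := e.symm k) (by rwa [hnorm]) Y
  rw [hnorm, hcomp] at hbound
  rw [integral_eq_lintegral_of_nonneg_ae (Filter.Eventually.of_forall fun x => by
    simp only [Pi.zero_apply]; positivity) (by fun_prop)]
  exact ENNReal.toReal_le_of_le_ofReal (by positivity) hbound
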